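/- Let m ≥ 3 and let ρ : C_m → GL_n(ℤ) be a faithful representation of the cyclic group C_m of order m, making ℤⁿ into a ℤC_m-module. If m is divisible by some prime larger than 3, then rk_{C_m}(ℤⁿ) ≤ n − 3. -/

import Mathlib

/-- The minimal number of generators of `ℤⁿ` as a `ℤG`-module, where the
`G`-action on `ℤⁿ` is given by the integral representation `ρ : G → GL_n(ℤ)`. -/
noncomputable def moduleRank (n : ℕ) {G : Type*} [Group G]
    (ρ : G →* Matrix.GeneralLinearGroup (Fin n) ℤ) : ℕ :=
  sInf {k | ∃ S : Finset (Fin n → ℤ), S.card = k ∧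
    Submodule.span ℤ
      {x | ∃ g : G, ∃ s ∈ S, x = ((ρ g : Matrix (Fin n) (Fin n) ℤ)).mulVec s} = ⊤}

open NumberField Polynomial

/-- The powers of a primitive `p`-th root of unity satisfy only the obvious linear relation
over `ℤ`. -/
lemma IsPrimitiveRoot.coeff_eq_of_sum_eq_zero {K : Type*} [Field K] [CharZero K]
    {p : ℕ} (hp : p.Prime) {ζ : K} (hζ : IsPrimitiveRoot ζ p) {b : ℕ → ℤ}
    (h : ∑ i ∈ Finset.range p, (b i : K) * ζ ^ i = 0) {i : ℕ} (hi : i < p) :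
    b i = b (p - 1) := by
  set Q : ℤ[X] := ∑ i ∈ Finset.range p, C (b i - b (p - 1)) * X ^ i with hQ
  have hcoeff (k : ℕ) (hk : k < p) : Q.coeff k = b k - b (p - 1) := by
    simp only [hQ, finsetSum_coeff, coeff_C_mul_X_pow]
    simp [hk]
  have hdeg : Q.natDegree < p - 1 := by
    have hle : Q.natDegree ≤ p - 1 := by
      refine natDegree_sum_le_of_forall_le _ _ fun i hi => ?_
      exact (natDegree_C_mul_X_pow_le _ _).trans (by have := Finset.mem_range.1 hi; omega)
    refine lt_of_le_of_ne hle fun heq => ?_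
    have hlead : Q.leadingCoeff = 0 := by
      rw [leadingCoeff, heq, hcoeff _ (by have := hp.pos; omega), sub_self]
    rw [leadingCoeff_eq_zero.1 hlead, natDegree_zero] at heq
    have := hp.two_le
    omega
  have haeval : aeval ζ Q = 0 := by
    have hgeom := hζ.geom_sum_eq_zero hp.one_lt
    simp only [hQ, map_sum, map_mul, map_pow, aeval_X, aeval_C, map_sub, sub_mul,
      Finset.sum_sub_distrib, ← Finset.mul_sum, hgeom]
    simpa using h
  have hdvd : cyclotomic p ℤ ∣ Q := by
    rw [cyclotomic_eq_minpoly hζ hp.pos]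
    exact minpoly.isIntegrallyClosed_dvd (hζ.isIntegral hp.pos) haeval
  have hzero : Q = 0 := eq_zero_of_dvd_of_natDegree_lt hdvd (by
    rwa [natDegree_cyclotomic, Nat.totient_prime hp])
  have := hcoeff i hi
  rw [hzero, coeff_zero] at this
  omega

/-- An endomorphism of prime order `p` of a free `ℤ`-module admits a nonzero linear map to any
domain with a primitive `p`-th root of unity `ζ`, intertwining it with multiplication by `ζ`. -/
lemma exists_linearMap_intertwining {R M : Type*} [CommRing R] [IsDomain R] [CharZero R]
    [AddCommGroup M] [Module.Free ℤ M] {p : ℕ} (hp : p.Prime) {ζ : R} (hζ : IsPrimitiveRoot ζ p)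
    {σ : Module.End ℤ M} (hσ : σ ^ p = 1) (hne : σ ≠ 1) :
    ∃ f : M →ₗ[ℤ] R, f ≠ 0 ∧ ∀ x, f (σ x) = ζ * f x := by
  obtain ⟨x, hx⟩ : ∃ x, σ x ≠ x := by
    by_contra! h
    exact hne (LinearMap.ext h)
  let B := Module.Free.chooseBasis ℤ M
  obtain ⟨j, hj⟩ : ∃ j, B.coord j (σ x) ≠ B.coord j x := by
    by_contra! h
    exact hx (B.ext_elem h)
  let f : M →ₗ[ℤ] R := ∑ i ∈ Finset.range p,
    ((B.coord j).comp (σ ^ i)).smulRight (ζ ^ (p - 1 - i))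
  have hf (y : M) : f y =
      ∑ i ∈ Finset.range p, ((B.coord j ((σ ^ i) y) : ℤ) : R) * ζ ^ (p - 1 - i) := by
    simp [f, LinearMap.sum_apply]
  refine ⟨f, fun h0 => hj ?_, fun y => ?_⟩
  · have hsum := hf x
    rw [h0, LinearMap.zero_apply, ← Finset.sum_range_reflect] at hsum
    have hsum' : ∑ i ∈ Finset.range p,
        (((fun i => B.coord j ((σ ^ (p - 1 - i)) x)) i : ℤ) : R) * ζ ^ i = 0 := by
      rw [hsum]
      refine Finset.sum_congr rfl fun i hi => ?_
      have := Finset.mem_range.1 hi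
      rw [show p - 1 - (p - 1 - i) = i by omega]
    have h2 := hp.two_le
    have hinj := IsFractionRing.injective R (FractionRing R)
    have hsumK := congrArg (algebraMap R (FractionRing R)) hsum'
    simp only [map_sum, map_mul, map_pow, map_intCast, map_zero] at hsumK
    have := (hζ.map_of_injective hinj).coeff_eq_of_sum_eq_zero hp hsumK
      (show p - 1 - 1 < p by omega)
    simpa [show p - 1 - (p - 1 - 1) = 1 by omega] using this
  · rw [hf, hf, Finset.mul_sum]
    let b : ℕ → R := fun i => ((B.coord j ((σ ^ i) y) : ℤ) : R) * ζ ^ (p - i)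
    have hl : ∀ i ∈ Finset.range p,
        ((B.coord j ((σ ^ i) (σ y)) : ℤ) : R) * ζ ^ (p - 1 - i) = b (i + 1) := by
      intro i _
      simp only [b, pow_succ, Module.End.mul_apply]
      rw [show p - (i + 1) = p - 1 - i by omega]
    have hr : ∀ i ∈ Finset.range p,
        ζ * (((B.coord j ((σ ^ i) y) : ℤ) : R) * ζ ^ (p - 1 - i)) = b i := by
      intro i hi
      have := Finset.mem_range.1 hi
      simp only [b]
      rw [show p - i = (p - 1 - i) + 1 by omega, pow_succ]
      ring
    rw [Finset.sum_congr rfl hl, Finset.sum_congr rfl hr]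
    have hb : b 0 = b p := by simp [b, hσ, hζ.pow_eq_one]
    have := (Finset.sum_range_succ b p).symm.trans (Finset.sum_range_succ' b p)
    rw [hb] at this
    exact (add_right_cancel this).symm

/-- A subgroup of `ℤ[ζ]` stable under multiplication by `ζ` is an ideal. -/
lemma mul_mem_of_adjoin_eq_top {R : Type*} [CommRing R] {ζ : R}
    (htop : Algebra.adjoin ℤ {ζ} = ⊤) {N : Submodule ℤ R} (hN : ∀ x ∈ N, ζ * x ∈ N) (c : R)
    {x : R} (hx : x ∈ N) : c * x ∈ N := by
  have hc : c ∈ Algebra.adjoin ℤ {ζ} := htop ▸ Algebra.mem_top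
  induction hc using Algebra.adjoin_induction generalizing x with
  | mem y hy => exact (Set.mem_singleton_iff.1 hy) ▸ hN x hx
  | algebraMap r => simpa using N.smul_mem r hx
  | add y z _ _ hy hz => rw [add_mul]; exact N.add_mem (hy hx) (hz hx)
  | mul y z _ _ hy hz => rw [mul_assoc]; exact hy (hz hx)

/-- If an equivariant linear map from `M` to `ℤ[ζ]` has as image an ideal with `k` generators,
then `M` is generated by `k` elements and a basis of the kernel. -/
lemma exists_generators_of_intertwining {R M : Type*} [CommRing R] [AddCommGroup M]
    [Module.Free ℤ M] [Module.Finite ℤ M] {ζ : R} (htop : Algebra.adjoin ℤ {ζ} = ⊤)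
    {σ : Module.End ℤ M} {f : M →ₗ[ℤ] R} (hf : ∀ x, f (σ x) = ζ * f x)
    {G : Finset R} (hG : (Ideal.span (G : Set R) : Set R) = LinearMap.range f) :
    ∃ S : Finset M, S.card ≤ G.card + Module.finrank ℤ (LinearMap.ker f) ∧
      ∀ T : Submodule ℤ M, (S : Set M) ⊆ T → (∀ x ∈ T, σ x ∈ T) → T = ⊤ := by
  classical
  have hlift : ∀ g ∈ G, ∃ x, f x = g := fun g hg => by
    have : g ∈ (LinearMap.range f : Set R) := hG ▸ Ideal.subset_span hg
    exact this
  choose! l hl using hlift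
  let B := Module.Free.chooseBasis ℤ (LinearMap.ker f)
  refine ⟨G.image l ∪ Finset.univ.image fun i => (B i : M), ?_, fun T hS hT => ?_⟩
  · refine (Finset.card_union_le _ _).trans (add_le_add Finset.card_image_le ?_)
    rw [Module.finrank_eq_card_basis B]
    exact Finset.card_image_le
  have hker : LinearMap.ker f ≤ T := by
    have : (⊤ : Submodule ℤ (LinearMap.ker f)) ≤ T.comap (LinearMap.ker f).subtype := by
      rw [← B.span_eq, Submodule.span_le]
      rintro _ ⟨i, rfl⟩
      exact hS (by simp)
    exact fun x hx => this (x := ⟨x, hx⟩) trivial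
  have hmul : ∀ y ∈ T.map f, ζ * y ∈ T.map f := by
    rintro _ ⟨x, hx, rfl⟩
    exact ⟨σ x, hT x hx, hf x⟩
  let J : Ideal R :=
    { (T.map f).toAddSubmonoid with
      smul_mem' := fun c _ hx => mul_mem_of_adjoin_eq_top htop hmul c hx }
  have hJ : Ideal.span (G : Set R) ≤ J := Ideal.span_le.2 fun g hg =>
    ⟨l g, hS (by simpa using Or.inl ⟨g, hg, rfl⟩), hl g hg⟩
  refine eq_top_iff.2 fun x _ => ?_
  have hx : f x ∈ Ideal.span (G : Set R) := by
    rw [← SetLike.mem_coe, hG]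
    exact ⟨x, rfl⟩
  obtain ⟨y, hy, hxy⟩ := hJ hx
  have := T.add_mem (hker (show x - y ∈ LinearMap.ker f by simp [hxy])) hy
  simpa using this

/-- A lattice with an automorphism `σ` of prime order greater than `3` is generated as a
`ℤ[σ]`-module by at most `rank - 3` elements. -/
lemma exists_generators_of_prime_order {M : Type*} [AddCommGroup M] [Module.Free ℤ M]
    [Module.Finite ℤ M] {p : ℕ} (hp : p.Prime) (hp3 : 3 < p) {σ : Module.End ℤ M}
    (hσ : σ ^ p = 1) (hne : σ ≠ 1) :
    ∃ S : Finset M, S.card + 3 ≤ Module.finrank ℤ M ∧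
      ∀ T : Submodule ℤ M, (S : Set M) ⊆ T → (∀ x ∈ T, σ x ∈ T) → T = ⊤ := by
  classical
  have : NeZero p := ⟨hp.ne_zero⟩
  have : IsCyclotomicExtension {p} ℚ (CyclotomicField p ℚ) :=
    CyclotomicField.isCyclotomicExtension p ℚ
  have hprim := IsCyclotomicExtension.zeta_spec p ℚ (CyclotomicField p ℚ)
  have htop : Algebra.adjoin ℤ {hprim.toInteger} = ⊤ :=
    IsCyclotomicExtension.Rat.adjoin_singleton_eq_top hprim
  obtain ⟨f, hf0, hf⟩ := exists_linearMap_intertwining hp hprim.toInteger_isPrimitiveRoot hσ hne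
  let I : Ideal (𝓞 (CyclotomicField p ℚ)) :=
    { (LinearMap.range f).toAddSubmonoid with
      smul_mem' := fun c _ hx => mul_mem_of_adjoin_eq_top htop (N := LinearMap.range f)
        (by rintro _ ⟨x, rfl⟩; exact ⟨σ x, hf x⟩) c hx }
  have hI : (I : Set (𝓞 (CyclotomicField p ℚ))) = LinearMap.range f := rfl
  obtain ⟨x, hx⟩ : ∃ x, f x ≠ 0 := by
    by_contra! h
    exact hf0 (LinearMap.ext h)
  have hI0 : I ≠ ⊥ := fun h => hx (by
    have : f x ∈ I := ⟨x, rfl⟩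
    simpa [h] using this)
  have hrank : Module.finrank ℤ (LinearMap.range f) = p - 1 := by
    have h := Ideal.finrank_eq_finrank (RingOfIntegers.basis (CyclotomicField p ℚ)) I hI0
    rw [RingOfIntegers.rank,
      IsCyclotomicExtension.finrank (n := p) _ (cyclotomic.irreducible_rat hp.pos),
      Nat.totient_prime hp] at h
    exact h
  have hadd : Module.finrank ℤ (LinearMap.ker f) + (p - 1) = Module.finrank ℤ M := by
    rw [← hrank, ← f.quotKerEquivRange.finrank_eq, add_comm]
    exact Submodule.finrank_quotient_add_finrank _
  obtain ⟨G, hGI, hG⟩ : ∃ G : Finset (𝓞 (CyclotomicField p ℚ)),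
      Ideal.span (G : Set (𝓞 (CyclotomicField p ℚ))) = I ∧ G.card + 3 ≤ p - 1 := by
    rcases eq_or_ne p 5 with rfl | h5
    · have := IsCyclotomicExtension.Rat.five_pid (CyclotomicField 5 ℚ)
      obtain ⟨a, ha⟩ := (IsPrincipalIdealRing.principal I).principal
      exact ⟨{a}, by rw [ha]; simp, by simp⟩
    · have hp6 : p ≠ 6 := by rintro rfl; exact absurd hp (by decide)
      have hp4 : p ≠ 4 := by rintro rfl; exact absurd hp (by decide)
      obtain ⟨y, hy⟩ := IsDedekindDomain.exists_eq_span_pair (I := I) ⟨x, rfl⟩ hx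
      refine ⟨{f x, y}, by rw [hy]; simp, ?_⟩
      have := Finset.card_le_two (a := f x) (b := y)
      omega
  obtain ⟨S, hS, hT⟩ := exists_generators_of_intertwining htop hf (G := G) (by rw [hGI, hI])
  exact ⟨S, by omega, hT⟩

/-- Let `m ≥ 3` and `ρ : C_m → GL_n(ℤ)` a faithful representation of the cyclic group of
order `m`. If `m` is divisible by some prime larger than `3`, then `rk_{C_m}(ℤⁿ) ≤ n - 3`. -/
theorem rank_le_of_faithful_cyclic_rep_of_large_prime_dvd (n m : ℕ) (hm : 3 ≤ m)
    (ρ : Multiplicative (ZMod m) →* Matrix.GeneralLinearGroup (Fin n) ℤ)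
    (hρ : Function.Injective ρ)
    (hdvd : ∃ p : ℕ, p.Prime ∧ 3 < p ∧ p ∣ m) :
    (moduleRank n ρ : ℤ) ≤ (n : ℤ) - 3 := by
  obtain ⟨p, hp, hp3, k, rfl⟩ := hdvd
  let g : Multiplicative (ZMod (p * k)) := Multiplicative.ofAdd (k : ZMod (p * k))
  have hgp : g ^ p = 1 := by
    rw [← ofAdd_nsmul, nsmul_eq_mul, ← Nat.cast_mul, ZMod.natCast_self, ofAdd_zero]
  have hg : g ≠ 1 := by
    intro h
    have h0 : (k : ZMod (p * k)) = 0 := h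
    rw [ZMod.natCast_eq_zero_iff] at h0
    have := Nat.le_of_dvd (Nat.pos_of_ne_zero (by rintro rfl; omega)) h0
    nlinarith
  let A : Matrix (Fin n) (Fin n) ℤ := ρ g
  have hA : A ^ p = 1 := by
    simp only [A, ← Units.val_pow_eq_pow_val, ← map_pow, hgp, map_one, Units.val_one]
  have hA1 : A ≠ 1 := fun h => hg (hρ (by
    rw [map_one]
    exact Units.ext h))
  obtain ⟨S, hS, hT⟩ := exists_generators_of_prime_order hp hp3 (σ := Matrix.toLinAlgEquiv' A)
    (by rw [← map_pow, hA, map_one])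
    (fun h => hA1 (Matrix.toLinAlgEquiv'.injective (by rw [h, map_one])))
  have hle : moduleRank n ρ ≤ S.card := by
    refine Nat.sInf_le ⟨S, rfl, hT _ (fun s hs => Submodule.subset_span ⟨1, s, hs, by simp⟩) ?_⟩
    intro x hx
    induction hx using Submodule.span_induction with
    | mem x h =>
      obtain ⟨u, s, hs, rfl⟩ := h
      exact Submodule.subset_span ⟨g * u, s, hs, by simp [A, Matrix.mulVec_mulVec]⟩
    | zero => simp
    | add x y _ _ hx hy => rw [map_add]; exact Submodule.add_mem _ hx hy
    | smul a x _ hx => rw [map_smul]; exact Submodule.smul_mem _ a hx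
  rw [Module.finrank_fin_fun] at hS
  omega
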